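/- For every admissible triple l the function g_l is a joint eigenfunction of the genus 2 dual Toda operators: for each k ∈ {1,2,3} and every j ∈ ℤ_{≥0}^3 one has (t q^{l_k} + t^{−1} q^{−l_k}) · g_l(j) = (t q^{j_k} + t^{−1} q^{−j_k}) · g_l(j) − q^{−(j_k+2)} · g_l(j + 2δ^k), where δ^1 = (1,0,0), δ^2 = (0,1,0), δ^3 = (0,0,1). -/

import Mathlib

/-!
STATEMENT 14: For every admissible triple `l` the function `g_l` is a joint eigenfunction
of the genus 2 dual Toda operators: for each `k ∈ {1,2,3}` and every `j ∈ ℤ_{≥0}³`,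
`(t q^{l_k} + t⁻¹ q^{−l_k})·g_l(j) = (t q^{j_k} + t⁻¹ q^{−j_k})·g_l(j) − q^{−(j_k+2)}·g_l(j + 2δ^k)`.

We realize `ℚ(q,t)` as `RatFunc (RatFunc ℚ)` (inner variable `q`, outer variable `t`);
triples are functions `Fin 3 → ℤ`, and `δ^k = Pi.single k 1` (so `2δ^k = Pi.single k 2`).
Admissibility of `l`: all `l_k ≥ 0`, `Σl` even, and the triangle inequalities
`l_a ≤ l_b + l_c` (equivalently `2 l_a ≤ Σl`).
-/

noncomputable section

/-- The field `ℚ(q,t)`. -/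
abbrev K : Type := RatFunc (RatFunc ℚ)

/-- The element `q`. -/
def q : K := RatFunc.C RatFunc.X

/-- The element `t`. -/
def t : K := RatFunc.X

/-- The q-Pochhammer symbol `(a;q²)_m = ∏_{k=0}^{m-1} (1 - (q²)^k a)`. -/
def poch (a : K) (m : ℕ) : K := ∏ k ∈ Finset.range m, (1 - (q ^ 2) ^ k * a)

/-- The eigenfunction `g_l : ℤ³ → ℚ(q,t)`: zero unless `j ∈ ℤ_{≥0}³` and
`(l_k − j_k)/2 ∈ ℤ_{≥0}` for all `k`, and otherwise
`g_l(j) = (q²t⁻¹)^{(Σj+Σl)/2} ∏_k (q^{−2l_k};q²)_{(j_k+l_k)/2} (t²;q²)_{(j_k+l_k)/2}`. -/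
def g (l j : Fin 3 → ℤ) : K :=
  if ∀ i, 0 ≤ j i ∧ j i ≤ l i ∧ (l i - j i) % 2 = 0 then
    (q ^ 2 * t⁻¹) ^ (((∑ i, j i) + ∑ i, l i) / 2) *
      ∏ i, (poch (q ^ (-2 * l i)) ((j i + l i) / 2).toNat
            * poch (t ^ 2) ((j i + l i) / 2).toNat)
  else 0

theorem q_ne_zero' : q ≠ 0 := by
  unfold q
  simp [RatFunc.X_ne_zero]

theorem t_ne_zero' : t ≠ 0 := by
  unfold t
  exact RatFunc.X_ne_zero

theorem poch_step (a : K) (m : ℤ) (hm : 0 ≤ m) :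
    poch a (m + 1).toNat = poch a m.toNat * (1 - q ^ (2 * m) * a) := by
  obtain ⟨n, rfl⟩ := Int.eq_ofNat_of_zero_le hm
  have h1 : ((n : ℤ) + 1).toNat = n + 1 := by omega
  rw [h1, Int.toNat_natCast]
  unfold poch
  rw [Finset.prod_range_succ, zpow_mul]
  norm_cast

theorem scalar_identity (a b m : ℤ) (hm : a + b = 2 * m) :
    q ^ (-(a + 2)) * ((q ^ 2 * t⁻¹) * ((1 - q ^ (2 * m) * q ^ (-2 * b)) * (1 - q ^ (2 * m) * t ^ 2)))
      = (t * q ^ a + t⁻¹ * q ^ (-a)) - (t * q ^ b + t⁻¹ * q ^ (-b)) := by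
  have hq := q_ne_zero'
  have ht := t_ne_zero'
  have e1 : q ^ (-2 * b) = (q ^ b)⁻¹ * (q ^ b)⁻¹ := by
    rw [← zpow_neg, ← zpow_add₀ hq]; congr 1; ring
  have e2 : q ^ (-(a + 2)) = (q ^ a)⁻¹ * (q ^ 2)⁻¹ := by
    rw [zpow_neg, zpow_add₀ hq, mul_inv]; norm_cast
  rw [← hm, e1, e2, zpow_add₀ hq, zpow_neg, zpow_neg]
  have ha : q ^ a ≠ 0 := zpow_ne_zero _ hq
  have hb : q ^ b ≠ 0 := zpow_ne_zero _ hq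
  generalize q ^ a = A at *
  generalize q ^ b = B at *
  field_simp
  ring

/-- The joint eigenfunction equation for the genus 2 dual Toda operators. -/
theorem genus2_dual_toda_eigenfunction (l : Fin 3 → ℤ)
    (hpos : ∀ i, 0 ≤ l i) (heven : (∑ i, l i) % 2 = 0)
    (htri : ∀ i, 2 * l i ≤ ∑ i', l i')
    (j : Fin 3 → ℤ) (hj : ∀ i, 0 ≤ j i) (k : Fin 3) :
    (t * q ^ (l k) + t⁻¹ * q ^ (-(l k))) * g l j
      = (t * q ^ (j k) + t⁻¹ * q ^ (-(j k))) * g l j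
        - q ^ (-(j k + 2)) * g l (j + Pi.single k 2) := by
  by_cases hS : ∀ i, 0 ≤ j i ∧ j i ≤ l i ∧ (l i - j i) % 2 = 0
  · obtain ⟨m, hm⟩ : ∃ m, j k + l k = 2 * m := ⟨(j k + l k) / 2, by have := hS k; omega⟩
    have hm0 : 0 ≤ m := by have := hj k; have := hpos k; omega
    have key := scalar_identity (j k) (l k) m hm
    have hstep : g l (j + Pi.single k 2) = g l j *
        ((q ^ 2 * t⁻¹) * ((1 - q ^ (2 * m) * q ^ (-2 * l k)) * (1 - q ^ (2 * m) * t ^ 2))) := by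
      by_cases hlt : j k = l k
      · have hn : ¬ ∀ i, 0 ≤ (j + Pi.single k 2 : Fin 3 → ℤ) i ∧ (j + Pi.single k 2 : Fin 3 → ℤ) i ≤ l i ∧
            (l i - (j + Pi.single k 2 : Fin 3 → ℤ) i) % 2 = 0 := by
          intro h
          have := h k
          simp only [Pi.add_apply, Pi.single_eq_same] at this
          omega
        have h0 : q ^ (2 * m) * q ^ (-2 * l k) = 1 := by
          rw [← zpow_add₀ q_ne_zero', show 2 * m + -2 * l k = 0 by omega, zpow_zero]
        rw [h0]
        unfold g
        rw [if_neg hn]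
        ring
      · have hp : ∀ i, 0 ≤ (j + Pi.single k 2 : Fin 3 → ℤ) i ∧ (j + Pi.single k 2 : Fin 3 → ℤ) i ≤ l i ∧
            (l i - (j + Pi.single k 2 : Fin 3 → ℤ) i) % 2 = 0 := by
          intro i
          have := hS i
          by_cases hik : i = k
          · subst hik
            simp only [Pi.add_apply, Pi.single_eq_same]
            omega
          · simpa [Pi.add_apply, Pi.single_eq_of_ne hik] using this
        have hsum : ((∑ i, (j + Pi.single k 2 : Fin 3 → ℤ) i) + ∑ i, l i) / 2
            = ((∑ i, j i) + ∑ i, l i) / 2 + 1 := by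
          have : ∑ i, (j + Pi.single k 2 : Fin 3 → ℤ) i = (∑ i, j i) + 2 := by
            simp [Finset.sum_add_distrib]
          rw [this]; omega
        have hb : q ^ 2 * t⁻¹ ≠ 0 :=
          mul_ne_zero (pow_ne_zero _ q_ne_zero') (inv_ne_zero t_ne_zero')
        unfold g
        rw [if_pos hp, if_pos hS, hsum, zpow_add_one₀ hb,
          ← Finset.mul_prod_erase _ _ (Finset.mem_univ k),
          ← Finset.mul_prod_erase Finset.univ (fun i => poch (q ^ (-2 * l i)) ((j i + l i) / 2).toNat
            * poch (t ^ 2) ((j i + l i) / 2).toNat) (Finset.mem_univ k)]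
        have hprod : ∏ i ∈ Finset.univ.erase k,
            (poch (q ^ (-2 * l i)) (((j + Pi.single k 2 : Fin 3 → ℤ) i + l i) / 2).toNat
              * poch (t ^ 2) (((j + Pi.single k 2 : Fin 3 → ℤ) i + l i) / 2).toNat)
            = ∏ i ∈ Finset.univ.erase k, (poch (q ^ (-2 * l i)) ((j i + l i) / 2).toNat
              * poch (t ^ 2) ((j i + l i) / 2).toNat) := by
          refine Finset.prod_congr rfl fun i hi => ?_
          rw [Pi.add_apply, Pi.single_eq_of_ne (Finset.ne_of_mem_erase hi), add_zero]
        have e1 : ((j + Pi.single k 2 : Fin 3 → ℤ) k + l k) / 2 = m + 1 := by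
          simp only [Pi.add_apply, Pi.single_eq_same]; omega
        have e2 : (j k + l k) / 2 = m := by omega
        rw [hprod, e1, e2, poch_step _ m hm0, poch_step _ m hm0]
        ring
    rw [hstep]
    linear_combination (g l j) * key
  · have hn : ¬ ∀ i, 0 ≤ (j + Pi.single k 2 : Fin 3 → ℤ) i ∧ (j + Pi.single k 2 : Fin 3 → ℤ) i ≤ l i ∧
        (l i - (j + Pi.single k 2 : Fin 3 → ℤ) i) % 2 = 0 := by
      intro h
      apply hS
      intro i
      have h1 := h i
      have h2 := hj i
      by_cases hik : i = k
      · subst hik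
        simp only [Pi.add_apply, Pi.single_eq_same] at h1
        omega
      · simpa [Pi.add_apply, Pi.single_eq_of_ne hik] using h1
    unfold g
    rw [if_neg hn, if_neg hS]
    ring

end
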